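/- arXiv:1901.07908 — 2 statements merged into one kernel-verified Lean document; each statement's English description precedes it below -/
import Mathlib

section
/- Let d ≥ 3 be an integer and let n be a positive integer with n ≡ −1 (mod d). Then ∑_{k=0}^{n−1} (q;q^d)_k^d · q^{dk} / (q^d;q^d)_k^d ≡ 0 (mod Φ_n(q)^2), as an identity of rational functions of q over ℚ (in fact each summand here is a polynomial of q divided by a polynomial coprime to Φ_n(q)). -/
open Finset Polynomial

/-- The q-shifted factorial `(x; q)_k = ∏_{j=0}^{k-1} (1 - x q^j)` in `RatFunc ℚ`. -/
noncomputable def qPoch (x q : RatFunc ℚ) (k : ℕ) : RatFunc ℚ :=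
  ∏ j ∈ Finset.range k, (1 - x * q ^ j)

/-- `A ≡ 0 (mod P)`: `A = P · B` for some rational function `B` whose denominator
(in lowest terms) is coprime to `P`. -/
def CongrZero (A : RatFunc ℚ) (P : Polynomial ℚ) : Prop :=
  ∃ B : RatFunc ℚ, A = algebraMap (Polynomial ℚ) (RatFunc ℚ) P * B ∧ IsCoprime B.denom P

section CommRing

variable {R : Type*} [CommRing R]

/-- If `a * Q ^ M = 1`, the terminating `q`-binomial sum `∑ (a; Q)_k / (Q; Q)_k z ^ k` vanishes at
`z = Q ^ i` for `1 ≤ i ≤ M`. The sequence `w` holds the inverses of `1 - Q ^ (j + 1)`. -/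
theorem sum_qBinomial_pow_eq_zero {Q a : R} {w : ℕ → R} {M N : ℕ} (hMN : M ≤ N)
    (hw : ∀ j < N, (1 - Q ^ (j + 1)) * w j = 1) (ha : a * Q ^ M = 1) {i : ℕ} (hi : i < M) :
    ∑ k ∈ range (N + 1), (∏ j ∈ range k, (1 - a * Q ^ j) * w j) * (Q ^ k) ^ (i + 1) = 0 := by
  set c : ℕ → R := fun k => ∏ j ∈ range k, (1 - a * Q ^ j) * w j with hc
  have hstep : ∀ k < N, c (k + 1) * (1 - Q ^ (k + 1)) = c k * (1 - a * Q ^ k) := by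
    intro k hk
    simp only [hc, prod_range_succ]
    linear_combination (∏ j ∈ range k, (1 - a * Q ^ j) * w j) * (1 - a * Q ^ k) * hw k hk
  have hlast : c N * (1 - a * Q ^ N) = 0 := by
    rcases hMN.eq_or_lt with rfl | hlt
    · rw [ha, sub_self, mul_zero]
    · have : c N = 0 := prod_eq_zero (mem_range.2 hlt) (by rw [ha, sub_self, zero_mul])
      rw [this, zero_mul]
  have hfun : ∀ z : R, ∑ k ∈ range (N + 1), c k * (1 - Q ^ k) * z ^ k
      = z * ∑ k ∈ range (N + 1), c k * (1 - a * Q ^ k) * z ^ k := by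
    intro z
    rw [sum_range_succ', sum_range_succ, hlast, mul_add, mul_sum]
    simp only [pow_zero, sub_self, mul_zero, zero_mul, add_zero]
    refine sum_congr rfl fun k hk => ?_
    rw [hstep k (mem_range.1 hk)]
    ring
  have hrec : ∀ i, (1 - Q ^ i) * ∑ k ∈ range (N + 1), c k * (Q ^ k) ^ i
      = (1 - a * Q ^ i) * ∑ k ∈ range (N + 1), c k * (Q ^ k) ^ (i + 1) := by
    intro i
    have h := hfun (Q ^ i)
    simp only [mul_sum] at h ⊢
    rw [← sub_eq_zero, ← sum_sub_distrib] at h ⊢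
    rw [← h]
    refine sum_congr rfl fun k _ => ?_
    rw [pow_right_comm Q i k]
    ring
  induction i with
  | zero =>
    have h := hrec 0
    rw [pow_zero, sub_self, zero_mul, mul_one] at h
    have hwM := hw (M - 1) (by omega)
    rw [show M - 1 + 1 = M by omega] at hwM
    have key : ∀ s : R, 0 = (1 - a) * s → s = 0 := fun s hs => by
      linear_combination (-s) * hwM + w (M - 1) * Q ^ M * hs - s * w (M - 1) * ha
    exact key _ h
  | succ i ih =>
    have h := hrec (i + 1)
    rw [ih (by omega), mul_zero] at h
    have hwM := hw (M - (i + 1) - 1) (by omega)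
    rw [show M - (i + 1) - 1 + 1 = M - (i + 1) by omega] at hwM
    have hQ : Q ^ (M - (i + 1)) * Q ^ (i + 1) = Q ^ M := by
      rw [← pow_add]; congr 1; omega
    have key : ∀ s : R, 0 = (1 - a * Q ^ (i + 1)) * s → s = 0 := fun s hs => by
      linear_combination (-s) * hwM + w (M - (i + 1) - 1) * Q ^ (M - (i + 1)) * hs
        - s * w (M - (i + 1) - 1) * ha - s * w (M - (i + 1) - 1) * a * hQ
    exact key _ h

theorem sum_qBinomial_eval_eq_zero {Q a : R} {w : ℕ → R} {M N : ℕ} (hMN : M ≤ N)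
    (hw : ∀ j < N, (1 - Q ^ (j + 1)) * w j = 1) (ha : a * Q ^ M = 1) {p : R[X]}
    (hp : p.natDegree < M) :
    ∑ k ∈ range (N + 1), (∏ j ∈ range k, (1 - a * Q ^ j) * w j) * (Q ^ k * p.eval (Q ^ k)) = 0 := by
  simp only [eval_eq_sum_range, mul_sum]
  rw [sum_comm]
  refine sum_eq_zero fun i hi => ?_
  have h := sum_qBinomial_pow_eq_zero hMN hw ha (i := i) (by have := mem_range.1 hi; omega)
  rw [← mul_zero (p.coeff i), ← h, mul_sum]
  exact sum_congr rfl fun k _ => by ring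

/-- `(Q ^ (r + 1); Q)_k / (Q; Q)_k` is a polynomial of degree at most `r` in `Q ^ k`. -/
theorem exists_eval_eq_prod_qPoch (Q : R) (w : ℕ → R) (r N : ℕ) (hr : r ≤ N)
    (hw : ∀ j < N, (1 - Q ^ (j + 1)) * w j = 1) :
    ∃ g : R[X], g.natDegree ≤ r ∧
      ∀ k ≤ N, ∏ j ∈ range k, (1 - Q ^ (r + 1) * Q ^ j) * w j = g.eval (Q ^ k) := by
  refine ⟨C (∏ i ∈ range r, w i) * ∏ i ∈ range r, (1 - C (Q ^ (i + 1)) * X), ?_, fun k hk => ?_⟩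
  · refine (natDegree_C_mul_le _ _).trans ((natDegree_prod_le _ _).trans ?_)
    refine (sum_le_card_nsmul _ _ 1 fun i _ => ?_).trans (by simp)
    compute_degree
  · have hone : ∀ l ≤ N, (∏ j ∈ range l, (1 - Q ^ (j + 1))) * ∏ j ∈ range l, w j = 1 := by
      intro l hl
      rw [← prod_mul_distrib]
      exact prod_eq_one fun j hj => hw j ((mem_range.1 hj).trans_le hl)
    have h1 := prod_range_add (fun j => 1 - Q ^ (j + 1)) r k
    have h2 := prod_range_add (fun j => 1 - Q ^ (j + 1)) k r
    rw [add_comm k r, h1] at h2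
    have hA : ∏ j ∈ range k, (1 - Q ^ (r + 1) * Q ^ j) = ∏ j ∈ range k, (1 - Q ^ (r + j + 1)) :=
      prod_congr rfl fun j _ => by ring
    have hB : ∏ j ∈ range r, (1 - Q ^ (j + 1) * Q ^ k) = ∏ j ∈ range r, (1 - Q ^ (k + j + 1)) :=
      prod_congr rfl fun j _ => by ring
    simp only [eval_mul, eval_C, eval_prod, eval_sub, eval_one, eval_X, prod_mul_distrib]
    rw [hA, hB]
    linear_combination (-(∏ j ∈ range k, w j) * ∏ j ∈ range k, (1 - Q ^ (r + j + 1))) * hone r hr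
      + (∏ j ∈ range r, w j) * (∏ j ∈ range k, w j) * h2
      + (∏ j ∈ range r, w j) * (∏ j ∈ range r, (1 - Q ^ (k + j + 1))) * hone k hk

theorem add_pow_of_sq_eq_zero (x z : R) (hz : z ^ 2 = 0) (k : ℕ) :
    (x + z) ^ k = x ^ k + k * x ^ (k - 1) * z := by
  simpa [derivative_X_pow] using eval_add_of_sq_eq_zero (X ^ k : R[X]) x z hz

/-- To first order at `t = 1`, a product of values of `f` at powers of `t` depends only on the
sum of the exponents. -/
theorem eval_pow_eq_of_sq_eq_zero (f : R[X]) {t : R} (ht : (t - 1) ^ 2 = 0) (e : ℕ) :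
    f.eval (t ^ e) ^ (e + 1) = f.eval (t ^ (e + 1)) ^ e * f.eval 1 := by
  have hpow : ∀ k : ℕ, t ^ k = 1 + k * (t - 1) := fun k => by
    simpa using add_pow_of_sq_eq_zero 1 (t - 1) ht k
  have hsq : ∀ x : R, (x * (t - 1)) ^ 2 = 0 := fun x => by rw [mul_pow, ht, mul_zero]
  have hf : ∀ k : ℕ, f.eval (t ^ k) = f.eval 1 + k * f.derivative.eval 1 * (t - 1) := fun k => by
    rw [hpow k, eval_add_of_sq_eq_zero f 1 _ (hsq _)]
    ring
  rw [hf, hf, add_pow_of_sq_eq_zero _ _ (hsq _), add_pow_of_sq_eq_zero _ _ (hsq _)]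
  cases e with
  | zero => simp
  | succ e =>
    simp only [Nat.add_sub_cancel]
    push_cast
    ring

theorem sum_qPoch_pow_eq_zero_of_sq_eq_zero {q : R} {w : ℕ → R} {e r n : ℕ} (he : 2 ≤ e)
    (hn : n + 1 = (e + 1) * (r + 1)) (hq : (q ^ n - 1) ^ 2 = 0)
    (hw : ∀ j < n - 1, (1 - (q ^ (e + 1)) ^ (j + 1)) * w j = 1) :
    ∑ k ∈ range n, (∏ j ∈ range k, (1 - q * (q ^ (e + 1)) ^ j) * w j) ^ (e + 1)
      * (q ^ (e + 1)) ^ k = 0 := by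
  obtain ⟨M, hM⟩ : ∃ M, M + 1 = e * (r + 1) := ⟨e * (r + 1) - 1, by
    have : 0 < e * (r + 1) := by positivity
    omega⟩
  have hnM : n = M + (r + 1) := by linarith [add_mul e 1 (r + 1)]
  have hmul : 1 + (e + 1) * M = n * e := by
    subst hnM
    linear_combination (e + 1) * hM - e * hM
  set t := q ^ n with ht
  set Q := q ^ (e + 1) with hQ
  have htinv : t * (2 - t) = 1 := by linear_combination -hq
  have hqQ : q * Q ^ M = t ^ e := by
    rw [hQ, ht, ← pow_mul, ← pow_mul, ← hmul, pow_add, pow_one]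
  obtain ⟨a, ha, hqa⟩ : ∃ a, a * Q ^ M = 1 ∧ t ^ e * a = q := by
    have h : t ^ e * (2 - t) ^ e = 1 := by rw [← mul_pow, htinv, one_pow]
    exact ⟨q * (2 - t) ^ e, by linear_combination (2 - t) ^ e * hqQ + h,
      by linear_combination q * h⟩
  have hta : t ^ (e + 1) * a = Q ^ (r + 1) := by
    have h : t ^ (e + 1) = Q ^ M * Q ^ (r + 1) := by
      rw [ht, hQ, ← pow_add, ← pow_mul, ← pow_mul, ← hnM, mul_comm]
    linear_combination a * h + Q ^ (r + 1) * ha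
  have hn1 : n - 1 + 1 = n := by omega
  obtain ⟨g, hgdeg, hg⟩ := exists_eval_eq_prod_qPoch Q w r (n - 1) (by omega) hw
  have hdeg : (g ^ e).natDegree < M := by
    have h1 := natDegree_pow_le_of_le e hgdeg
    have h2 : M + 1 = e * r + e := by rw [hM]; ring
    omega
  have hsum := sum_qBinomial_eval_eq_zero (by omega) hw ha hdeg
  rw [hn1] at hsum
  rw [← hsum]
  refine sum_congr rfl fun k hk => ?_
  have hk := mem_range.1 hk
  have key := eval_pow_eq_of_sq_eq_zero
    (∏ j ∈ range k, (1 - C (a * Q ^ j) * X) * C (w j)) hq e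
  simp only [eval_prod, eval_mul, eval_sub, eval_one, eval_C, eval_X, mul_one] at key
  have h1 : ∏ j ∈ range k, (1 - q * Q ^ j) * w j
      = ∏ j ∈ range k, (1 - a * Q ^ j * t ^ e) * w j :=
    prod_congr rfl fun j _ => by rw [← hqa]; ring
  have h2 : ∏ j ∈ range k, (1 - a * Q ^ j * t ^ (e + 1)) * w j
      = ∏ j ∈ range k, (1 - Q ^ (r + 1) * Q ^ j) * w j :=
    prod_congr rfl fun j _ => by rw [← hta]; ring
  rw [h1, key, h2, hg k (by omega), eval_pow]
  ring

/-- The sum with denominators cleared by the common denominator `(Q; Q)_{n-1} ^ (e + 1)`. -/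
theorem sum_qPoch_pow_mul_eq_zero_of_sq_eq_zero {q : R} {e r n : ℕ} (he : 2 ≤ e)
    (hn : n + 1 = (e + 1) * (r + 1)) (hq : (q ^ n - 1) ^ 2 = 0)
    (hu : ∀ j < n - 1, IsUnit (1 - (q ^ (e + 1)) ^ (j + 1))) :
    ∑ k ∈ range n, (∏ j ∈ range k, (1 - q * (q ^ (e + 1)) ^ j)) ^ (e + 1) * q ^ ((e + 1) * k)
      * (∏ j ∈ Ico k (n - 1), (1 - (q ^ (e + 1)) ^ (j + 1))) ^ (e + 1) = 0 := by
  choose! w hw using fun j hj => (hu j hj).exists_right_inv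
  have h := sum_qPoch_pow_eq_zero_of_sq_eq_zero he hn hq hw
  rw [← mul_zero ((∏ j ∈ range (n - 1), (1 - (q ^ (e + 1)) ^ (j + 1))) ^ (e + 1)), ← h, mul_sum]
  refine sum_congr rfl fun k hk => ?_
  have hk := mem_range.1 hk
  have hone : (∏ j ∈ range k, (1 - (q ^ (e + 1)) ^ (j + 1))) * ∏ j ∈ range k, w j = 1 := by
    rw [← prod_mul_distrib]
    exact prod_eq_one fun j hj => hw j (by have := mem_range.1 hj; omega)
  rw [← prod_range_mul_prod_Ico _ (show k ≤ n - 1 by omega), prod_mul_distrib, pow_mul]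
  simp only [← mul_pow, mul_right_comm _ ((q ^ (e + 1)) ^ k), ← mul_assoc]
  congr 2
  linear_combination (-(∏ j ∈ range k, (1 - q * (q ^ (e + 1)) ^ j))
    * ∏ j ∈ Ico k (n - 1), (1 - (q ^ (e + 1)) ^ (j + 1))) * hone

end CommRing

theorem isCoprime_cyclotomic_one_sub_X_pow {n k : ℕ} (hk : 0 < k) (h : ¬ n ∣ k) :
    IsCoprime (cyclotomic n ℚ) (1 - X ^ k) := by
  rw [← neg_sub, ← prod_cyclotomic_eq_X_pow_sub_one hk, IsCoprime.neg_right_iff]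
  exact IsCoprime.prod_right fun i hi =>
    cyclotomic.isCoprime_rat fun hni => h (hni ▸ Nat.dvd_of_mem_divisors hi)

theorem sq_cyclotomic_dvd_sum_qPoch_pow {e r n : ℕ} (he : 2 ≤ e)
    (hn : n + 1 = (e + 1) * (r + 1))
    (hcop : ∀ j < n - 1, IsCoprime (cyclotomic n ℚ ^ 2) (1 - (X ^ (e + 1)) ^ (j + 1))) :
    cyclotomic n ℚ ^ 2 ∣ ∑ k ∈ range n,
      (∏ j ∈ range k, (1 - X * (X ^ (e + 1)) ^ j)) ^ (e + 1) * X ^ ((e + 1) * k)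
        * (∏ j ∈ Ico k (n - 1), (1 - (X ^ (e + 1)) ^ (j + 1))) ^ (e + 1) := by
  rw [← AdjoinRoot.mk_eq_zero]
  have h := sum_qPoch_pow_mul_eq_zero_of_sq_eq_zero (q := AdjoinRoot.mk (cyclotomic n ℚ ^ 2) X)
    he hn ?_ fun j hj => ?_
  · simpa only [map_sum, map_mul, map_pow, map_prod, map_sub, map_one] using h
  · rw [← map_pow, ← map_one (AdjoinRoot.mk (cyclotomic n ℚ ^ 2)), ← map_sub, ← map_pow,
      AdjoinRoot.mk_eq_zero]
    exact pow_dvd_pow_of_dvd (cyclotomic.dvd_X_pow_sub_one n ℚ) 2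
  · obtain ⟨u, v, huv⟩ := hcop j hj
    refine IsUnit.of_mul_eq_one_right (AdjoinRoot.mk (cyclotomic n ℚ ^ 2) v) ?_
    have := congrArg (AdjoinRoot.mk (cyclotomic n ℚ ^ 2)) huv
    simpa using this

theorem stmt1 (d : ℕ) (hd : 3 ≤ d) (n : ℕ) (hn : 0 < n)
    (hmod : (n : ℤ) ≡ -1 [ZMOD (d : ℤ)]) :
    CongrZero
      (∑ k ∈ Finset.range n,
        (qPoch (RatFunc.X : RatFunc ℚ) (RatFunc.X ^ d) k) ^ d * RatFunc.X ^ (d * k)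
          / (qPoch ((RatFunc.X : RatFunc ℚ) ^ d) (RatFunc.X ^ d) k) ^ d)
      ((Polynomial.cyclotomic n ℚ) ^ 2) := by
  obtain ⟨e, rfl⟩ : ∃ e, d = e + 1 := ⟨d - 1, by omega⟩
  obtain ⟨m, hm⟩ : e + 1 ∣ n + 1 := by
    have h := hmod.symm.dvd
    rw [sub_neg_eq_add] at h
    exact_mod_cast h
  obtain ⟨r, rfl⟩ : ∃ r, m = r + 1 := ⟨m - 1, by
    have : m ≠ 0 := by rintro rfl; simp at hm
    omega⟩
  have hndvd : Nat.Coprime n (e + 1) := by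
    have h : Nat.Coprime n (n + 1) := by simp
    exact h.coprime_dvd_right ⟨_, hm⟩
  have hcop : ∀ j < n - 1, IsCoprime (cyclotomic n ℚ ^ 2) (1 - (X ^ (e + 1)) ^ (j + 1)) := by
    intro j hj
    rw [← pow_mul]
    refine (isCoprime_cyclotomic_one_sub_X_pow (by positivity) fun h => ?_).pow_left
    have := Nat.le_of_dvd (by omega) (hndvd.dvd_of_dvd_mul_left h)
    omega
  set D : ℚ[X] := (∏ j ∈ range (n - 1), (1 - (X ^ (e + 1)) ^ (j + 1))) ^ (e + 1) with hD
  have hDcop : IsCoprime (cyclotomic n ℚ ^ 2) D :=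
    (IsCoprime.prod_right fun j hj => hcop j (mem_range.1 hj)).pow_right
  have hne : ∀ j : ℕ, (1 - (RatFunc.X ^ (e + 1)) ^ (j + 1) : RatFunc ℚ) ≠ 0 := by
    intro j h
    have h2 : (X ^ ((e + 1) * (j + 1)) - 1 : ℚ[X]) = 0 := by
      apply RatFunc.algebraMap_injective ℚ
      rw [map_sub, map_pow, RatFunc.algebraMap_X, map_one, map_zero, pow_mul, ← neg_sub, h, neg_zero]
    exact X_pow_sub_C_ne_zero (n := (e + 1) * (j + 1)) (by positivity) (1 : ℚ) (by simpa using h2)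
  have hD0 : algebraMap ℚ[X] (RatFunc ℚ) D ≠ 0 := by
    simp only [hD, map_pow, map_prod, map_sub, map_one, RatFunc.algebraMap_X]
    exact pow_ne_zero _ (prod_ne_zero_iff.2 fun j _ => hne j)
  obtain ⟨B, hB⟩ := sq_cyclotomic_dvd_sum_qPoch_pow (by omega) hm hcop
  refine ⟨algebraMap _ _ B / algebraMap _ _ D, ?_,
    (hDcop.of_isCoprime_of_dvd_right (RatFunc.denom_div_dvd B D)).symm⟩
  rw [mul_div_assoc', ← map_mul, ← hB, eq_div_iff hD0, map_sum, sum_mul]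
  refine sum_congr rfl fun k hk => ?_
  have hk := mem_range.1 hk
  have hprod : ∏ j ∈ range k, (1 - (RatFunc.X ^ (e + 1)) ^ (j + 1) : RatFunc ℚ) ≠ 0 :=
    prod_ne_zero_iff.2 fun j _ => hne j
  rw [hD, ← prod_range_mul_prod_Ico _ (show k ≤ n - 1 by omega)]
  simp only [qPoch, ← pow_succ', map_mul, map_pow, map_prod, map_sub, map_one,
    RatFunc.algebraMap_X, mul_pow]
  rw [div_mul_eq_mul_div, div_eq_iff (pow_ne_zero _ hprod)]
  ring
end

section
/- Let d ≥ 2 and n ≥ 2 be integers with n ≡ 1 (mod d). Then ∑_{k=0}^{n−1} (q^{−1};q^d)_k^d · q^{dk} / (q^d;q^d)_k^d ≡ 0 (mod Φ_n(q)^2), as rational functions of q over ℚ. -/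
open Finset Polynomial

/-- The localization of `ℚ[X]` at the polynomials coprime to `P`, inside `RatFunc ℚ`. -/
noncomputable def coprimeDenom (P : ℚ[X]) : Subring (RatFunc ℚ) where
  carrier := {A | IsCoprime A.denom P}
  mul_mem' := fun {a b} ha hb =>
    (IsCoprime.mul_left ha hb).of_isCoprime_of_dvd_left (RatFunc.denom_mul_dvd a b)
  one_mem' := by
    change IsCoprime (RatFunc.denom 1) P
    rw [RatFunc.denom_one]
    exact isCoprime_one_left
  add_mem' := fun {a b} ha hb =>
    (IsCoprime.mul_left ha hb).of_isCoprime_of_dvd_left (RatFunc.denom_add_dvd a b)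
  zero_mem' := by
    change IsCoprime (RatFunc.denom 0) P
    rw [RatFunc.denom_zero]
    exact isCoprime_one_left
  neg_mem' := fun {a} ha => by
    change IsCoprime (RatFunc.denom (-a)) P
    have h := RatFunc.denom_mul_dvd (RatFunc.C (-1)) a
    rw [RatFunc.denom_C, one_mul, map_neg, map_one, neg_one_mul] at h
    exact IsCoprime.of_isCoprime_of_dvd_left ha h

theorem mem_coprimeDenom {P : ℚ[X]} {A : RatFunc ℚ} :
    A ∈ coprimeDenom P ↔ IsCoprime A.denom P := Iff.rfl

theorem algebraMap_mem_coprimeDenom (P p : ℚ[X]) :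
    algebraMap ℚ[X] (RatFunc ℚ) p ∈ coprimeDenom P := by
  rw [mem_coprimeDenom, RatFunc.denom_algebraMap]
  exact isCoprime_one_left

theorem inv_algebraMap_mem_coprimeDenom {P s : ℚ[X]} (h : IsCoprime s P) :
    (algebraMap ℚ[X] (RatFunc ℚ) s)⁻¹ ∈ coprimeDenom P := by
  have h' := RatFunc.denom_div_dvd (1 : ℚ[X]) s
  rw [map_one, one_div] at h'
  exact h.of_isCoprime_of_dvd_left h'

theorem X_mem_coprimeDenom (P : ℚ[X]) : (RatFunc.X : RatFunc ℚ) ∈ coprimeDenom P := by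
  rw [← RatFunc.algebraMap_X]
  exact algebraMap_mem_coprimeDenom P X

theorem qPoch_succ (x q : RatFunc ℚ) (k : ℕ) :
    qPoch x q (k + 1) = qPoch x q k * (1 - x * q ^ k) :=
  Finset.prod_range_succ _ _

theorem qPoch_add (x q : RatFunc ℚ) (k l : ℕ) :
    qPoch x q (k + l) = qPoch x q k * qPoch (x * q ^ k) q l := by
  simp only [qPoch, Finset.prod_range_add]
  congr 1
  exact Finset.prod_congr rfl fun j _ => by ring

theorem qPoch_one_left_succ (q : RatFunc ℚ) (k : ℕ) : qPoch 1 q (k + 1) = 0 :=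
  Finset.prod_eq_zero (Finset.mem_range.2 k.succ_pos) (by simp)

theorem qPoch_self_ne_zero {q : RatFunc ℚ} (hq : ∀ j, q ^ (j + 1) ≠ 1) (k : ℕ) :
    qPoch q q k ≠ 0 :=
  Finset.prod_ne_zero_iff.2 fun j _ h => hq j (by rw [pow_succ']; exact (sub_eq_zero.1 h).symm)

theorem qPoch_inv_pow_eq_zero {q : RatFunc ℚ} (hq : q ≠ 0) {N k : ℕ} (h : N < k) :
    qPoch (q ^ N)⁻¹ q k = 0 :=
  Finset.prod_eq_zero (Finset.mem_range.2 h) (by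
    rw [inv_mul_cancel₀ (pow_ne_zero N hq), sub_self])

theorem qPoch_inv_pow_div_succ {q : RatFunc ℚ} (hq0 : q ≠ 0) (hq : ∀ j, q ^ (j + 1) ≠ 1)
    (N k : ℕ) :
    qPoch (q ^ (N + 1))⁻¹ q (k + 1) / qPoch q q (k + 1) =
      qPoch (q ^ N)⁻¹ q (k + 1) / qPoch q q (k + 1) -
        (q ^ (N + 1))⁻¹ * (qPoch (q ^ N)⁻¹ q k / qPoch q q k) := by
  have h1 : qPoch (q ^ (N + 1))⁻¹ q (k + 1) = (1 - (q ^ (N + 1))⁻¹) * qPoch (q ^ N)⁻¹ q k := by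
    rw [add_comm k 1, qPoch_add]
    congr 1
    · simp [qPoch]
    · congr 1
      field_simp
      ring
  have h2 := qPoch_self_ne_zero hq k
  have h3 : 1 - q * q ^ k ≠ 0 := fun h =>
    hq k (by rw [pow_succ']; exact (sub_eq_zero.1 h).symm)
  rw [h1, qPoch_succ (q ^ N)⁻¹, qPoch_succ q]
  field_simp
  ring

/-- The terminating `q`-binomial theorem. -/
theorem sum_qPoch_inv_pow_div {q : RatFunc ℚ} (hq0 : q ≠ 0) (hq : ∀ j, q ^ (j + 1) ≠ 1)
    (z : RatFunc ℚ) (N n : ℕ) (h : N < n) :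
    ∑ k ∈ Finset.range n, qPoch (q ^ N)⁻¹ q k / qPoch q q k * z ^ k =
      ∏ i ∈ Finset.range N, (1 - z * (q ^ (i + 1))⁻¹) := by
  induction N generalizing n with
  | zero =>
    obtain ⟨n, rfl⟩ := Nat.exists_eq_succ_of_ne_zero h.ne'
    rw [Finset.sum_range_succ']
    simp only [pow_zero, inv_one, qPoch_one_left_succ]
    simp [qPoch]
  | succ N ih =>
    obtain ⟨n, rfl⟩ := Nat.exists_eq_succ_of_ne_zero (Nat.ne_zero_of_lt h)
    have hN : N < n := Nat.lt_of_succ_lt_succ h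
    rw [Finset.prod_range_succ, ← ih n hN]
    have h1 := ih (n + 1) (Nat.lt_succ_of_lt hN)
    rw [← ih n hN, Finset.sum_range_succ'] at h1
    rw [Finset.sum_range_succ']
    simp only [qPoch_inv_pow_div_succ hq0 hq, sub_mul, Finset.sum_sub_distrib]
    have h2 : qPoch (q ^ (N + 1))⁻¹ q 0 = qPoch (q ^ N)⁻¹ q 0 := by simp [qPoch]
    rw [h2, mul_sub, mul_one]
    have h3 : ∑ k ∈ Finset.range n,
        (q ^ (N + 1))⁻¹ * (qPoch (q ^ N)⁻¹ q k / qPoch q q k) * z ^ (k + 1) =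
        (∑ k ∈ Finset.range n, qPoch (q ^ N)⁻¹ q k / qPoch q q k * z ^ k) *
          (z * (q ^ (N + 1))⁻¹) := by
      rw [Finset.sum_mul]
      exact Finset.sum_congr rfl fun k _ => by ring
    rw [h3]
    linear_combination h1

theorem sum_qPoch_inv_pow_div_mul_eval {q : RatFunc ℚ} (hq0 : q ≠ 0)
    (hq : ∀ j, q ^ (j + 1) ≠ 1) {N n : ℕ} (h : N < n) (f : (RatFunc ℚ)[X])
    (hf : f.natDegree < N) :
    ∑ k ∈ Finset.range n, qPoch (q ^ N)⁻¹ q k / qPoch q q k * (q ^ k * f.eval (q ^ k)) = 0 := by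
  simp only [eval_eq_sum_range, Finset.mul_sum]
  rw [Finset.sum_comm]
  refine Finset.sum_eq_zero fun i hi => ?_
  have hi' : i < N := by
    have := Finset.mem_range.1 hi
    omega
  have h1 := sum_qPoch_inv_pow_div hq0 hq (q ^ (i + 1)) N n h
  rw [Finset.prod_eq_zero (Finset.mem_range.2 hi')
    (by rw [mul_inv_cancel₀ (pow_ne_zero _ hq0), sub_self])] at h1
  rw [← mul_zero (f.coeff i), ← h1, Finset.mul_sum]
  refine Finset.sum_congr rfl fun k _ => ?_
  rw [← pow_mul, ← pow_mul]
  ring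

theorem exists_eval_eq_qPoch_div {q : RatFunc ℚ} (hq : ∀ j, q ^ (j + 1) ≠ 1) (r : ℕ) :
    ∃ f : (RatFunc ℚ)[X], f.natDegree ≤ r ∧
      ∀ k, qPoch (q ^ (r + 1)) q k / qPoch q q k = f.eval (q ^ k) := by
  refine ⟨C (qPoch q q r)⁻¹ * ∏ i ∈ Finset.range r, (1 - C (q ^ (i + 1)) * X), ?_, fun k => ?_⟩
  · refine (natDegree_C_mul_le _ _).trans ((natDegree_prod_le _ _).trans ?_)
    refine (Finset.sum_le_card_nsmul _ _ 1 fun i _ => ?_).trans (by simp)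
    exact (natDegree_sub_le _ _).trans (by
      simpa using natDegree_C_mul_le (q ^ (i + 1)) X)
  · have h1 : qPoch q q r * qPoch (q ^ (r + 1)) q k = qPoch q q k * qPoch (q ^ (k + 1)) q r := by
      rw [pow_succ', pow_succ', ← qPoch_add, ← qPoch_add, add_comm]
    have h2 : eval (q ^ k) (∏ i ∈ Finset.range r, (1 - C (q ^ (i + 1)) * X)) =
        qPoch (q ^ (k + 1)) q r := by
      rw [eval_prod, qPoch]
      refine Finset.prod_congr rfl fun i _ => ?_
      simp only [eval_sub, eval_one, eval_mul, eval_C, eval_X]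
      ring
    rw [eval_mul, eval_C, h2]
    have := qPoch_self_ne_zero hq k
    have := qPoch_self_ne_zero hq r
    field_simp
    linear_combination h1

theorem sum_qPoch_inv_pow_mul_qPoch_pow_eq_zero {q : RatFunc ℚ} (hq0 : q ≠ 0)
    (hq : ∀ j, q ^ (j + 1) ≠ 1) (e r n N : ℕ) (hN : e * r < N) (hn : N < n) :
    ∑ k ∈ Finset.range n, qPoch (q ^ N)⁻¹ q k * qPoch (q ^ (r + 1)) q k ^ e * q ^ k /
      qPoch q q k ^ (e + 1) = 0 := by
  obtain ⟨f, hf, hfk⟩ := exists_eval_eq_qPoch_div hq r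
  have hdeg : (f ^ e).natDegree < N :=
    (natDegree_pow_le.trans (Nat.mul_le_mul_left e hf)).trans_lt hN
  rw [← sum_qPoch_inv_pow_div_mul_eval hq0 hq hn (f ^ e) hdeg]
  refine Finset.sum_congr rfl fun k _ => ?_
  rw [eval_pow, ← hfk, div_pow]
  have := qPoch_self_ne_zero hq k
  field_simp
  ring

theorem one_sub_sq_dvd {R : Type*} [CommRing R] (a t : R) (e : ℕ) :
    (1 - t) ^ 2 ∣ (1 - a * t) ^ (e + 1) - (1 - a * t ^ (e + 1)) * (1 - a) ^ e := by
  obtain ⟨u, hu⟩ := Polynomial.powAddExpansion (1 - a) (a * (1 - t)) (e + 1)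
  obtain ⟨v, hv⟩ := Polynomial.powAddExpansion 1 (-(1 - t)) (e + 1)
  rw [show (1 - a) + a * (1 - t) = 1 - a * t by ring, Nat.add_sub_cancel] at hu
  rw [show (1 : R) + -(1 - t) = t by ring, one_pow, one_pow] at hv
  refine ⟨u * a ^ 2 + a * v * (1 - a) ^ e, ?_⟩
  rw [hu, hv]
  ring

theorem dvd_prod_sub_prod {R : Type*} [CommRing R] (p : R) (f g : ℕ → R)
    (h : ∀ j, p ∣ f j - g j) (k : ℕ) :
    p ∣ ∏ j ∈ Finset.range k, f j - ∏ j ∈ Finset.range k, g j := by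
  induction k with
  | zero => simp
  | succ k ih =>
    rw [Finset.prod_range_succ, Finset.prod_range_succ]
    exact dvd_mul_sub_mul ih (h k)

theorem dvd_qPoch_pow_sub {L : Subring (RatFunc ℚ)} {x t q : RatFunc ℚ} (hx : x ∈ L) (ht : t ∈ L)
    (hq : q ∈ L) (e k : ℕ) :
    ∃ c ∈ L, qPoch (x * t) q k ^ (e + 1) - qPoch (x * t ^ (e + 1)) q k * qPoch x q k ^ e =
      (1 - t) ^ 2 * c := by
  obtain ⟨⟨c, hc⟩, h⟩ := dvd_prod_sub_prod ((1 - ⟨t, ht⟩ : L) ^ 2) _ _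
    (fun j => one_sub_sq_dvd (⟨x, hx⟩ * ⟨q, hq⟩ ^ j : L) ⟨t, ht⟩ e) k
  refine ⟨c, hc, ?_⟩
  have h' := congrArg (L.subtype) h
  simp only [map_sub, map_mul, map_pow, map_prod, map_one, Subring.subtype_apply] at h'
  rw [← h']
  simp only [qPoch, ← Finset.prod_pow, ← Finset.prod_mul_distrib]
  congr 1 <;> refine Finset.prod_congr rfl fun j _ => by ring

theorem isCoprime_cyclotomic_of_aeval_ne_zero {n : ℕ} (hn : 0 < n) {p : ℚ[X]} {ζ : ℂ}
    (hζ : IsPrimitiveRoot ζ n) (hp : aeval ζ p ≠ 0) : IsCoprime p (cyclotomic n ℚ) := by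
  refine ((cyclotomic.irreducible_rat hn).coprime_iff_not_dvd.2 ?_).symm
  rintro ⟨c, rfl⟩
  apply hp
  have : aeval ζ (cyclotomic n ℚ) = 0 := by
    rw [aeval_def, eval₂_eq_eval_map, map_cyclotomic]
    exact hζ.isRoot_cyclotomic hn
  rw [map_mul, this, zero_mul]

theorem X_pow_ne_one (j : ℕ) : (RatFunc.X : RatFunc ℚ) ^ (j + 1) ≠ 1 := by
  rw [← RatFunc.algebraMap_X, ← map_pow, ← map_one (algebraMap ℚ[X] (RatFunc ℚ))]
  intro h
  have h' := congrArg (eval 0) (RatFunc.algebraMap_injective ℚ h)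
  simp at h'

theorem inv_X_mem_coprimeDenom {n : ℕ} (hn : 0 < n) :
    (RatFunc.X : RatFunc ℚ)⁻¹ ∈ coprimeDenom (cyclotomic n ℚ ^ 2) := by
  have hζ := Complex.isPrimitiveRoot_exp n hn.ne'
  rw [← RatFunc.algebraMap_X]
  refine inv_algebraMap_mem_coprimeDenom (IsCoprime.pow_right ?_)
  exact isCoprime_cyclotomic_of_aeval_ne_zero hn hζ (by simp)

theorem inv_qPoch_mem_coprimeDenom {d n k : ℕ} (hdn : n.Coprime d) (hk : k < n) :
    (qPoch ((RatFunc.X : RatFunc ℚ) ^ d) (RatFunc.X ^ d) k)⁻¹ ∈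
      coprimeDenom (cyclotomic n ℚ ^ 2) := by
  have hn : 0 < n := Nat.zero_lt_of_lt hk
  have hζ := Complex.isPrimitiveRoot_exp n hn.ne'
  rw [qPoch, ← Finset.prod_inv_distrib]
  refine Subring.prod_mem _ fun j hj => ?_
  have h : (1 - RatFunc.X ^ d * (RatFunc.X ^ d) ^ j : RatFunc ℚ) =
      algebraMap ℚ[X] (RatFunc ℚ) (1 - X ^ (d * (j + 1))) := by
    simp only [map_sub, map_one, map_pow, RatFunc.algebraMap_X]
    ring
  rw [h]
  refine inv_algebraMap_mem_coprimeDenom (IsCoprime.pow_right ?_)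
  refine isCoprime_cyclotomic_of_aeval_ne_zero hn hζ fun h0 => ?_
  simp only [map_sub, map_one, map_pow, aeval_X] at h0
  have hdvd := hdn.dvd_of_dvd_mul_left (hζ.dvd_of_pow_eq_one _ (sub_eq_zero.1 h0).symm)
  have := Nat.le_of_dvd j.succ_pos hdvd
  have := Finset.mem_range.1 hj
  omega

theorem stmt2 (d : ℕ) (hd : 2 ≤ d) (n : ℕ) (hn : 2 ≤ n)
    (hmod : n ≡ 1 [MOD d]) :
    CongrZero
      (∑ k ∈ Finset.range n,
        (qPoch ((RatFunc.X : RatFunc ℚ) ^ (-1 : ℤ)) (RatFunc.X ^ d) k) ^ d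
            * RatFunc.X ^ (d * k)
          / (qPoch ((RatFunc.X : RatFunc ℚ) ^ d) (RatFunc.X ^ d) k) ^ d)
      ((Polynomial.cyclotomic n ℚ) ^ 2) := by
  obtain ⟨e, rfl⟩ : ∃ e, d = e + 1 := ⟨d - 1, by omega⟩
  obtain ⟨r, rfl⟩ : ∃ r, n = (e + 1) * (r + 1) + 1 := by
    obtain ⟨m, hm⟩ := (Nat.modEq_iff_dvd' (by omega)).1 hmod.symm
    rcases m with _ | r
    · omega
    · exact ⟨r, by omega⟩
  set n := (e + 1) * (r + 1) + 1 with hn_def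
  have hn0 : 0 < n := by omega
  have hX : (RatFunc.X : RatFunc ℚ) ≠ 0 := RatFunc.X_ne_zero
  set L := coprimeDenom (cyclotomic n ℚ ^ 2) with hL
  have hXL : RatFunc.X ∈ L := X_mem_coprimeDenom _
  have hXiL : (RatFunc.X : RatFunc ℚ)⁻¹ ∈ L := inv_X_mem_coprimeDenom hn0
  have hcop : n.Coprime (e + 1) := by
    rw [hn_def]
    simp
  set q : RatFunc ℚ := RatFunc.X ^ (e + 1) with hq_def
  have hqL : q ∈ L := L.pow_mem hXL _
  have hq0 : q ≠ 0 := pow_ne_zero _ hX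
  have hq : ∀ j, q ^ (j + 1) ≠ 1 := fun j => by
    rw [hq_def, ← pow_mul, show (e + 1) * (j + 1) = (e * j + e + j) + 1 by ring]
    exact X_pow_ne_one _
  set t : RatFunc ℚ := RatFunc.X⁻¹ ^ n with ht_def
  have htL : t ∈ L := L.pow_mem hXiL _
  obtain ⟨c₀, hc₀, ht⟩ : ∃ c ∈ L,
      (1 - t) ^ 2 = algebraMap ℚ[X] (RatFunc ℚ) (cyclotomic n ℚ ^ 2) * c := by
    obtain ⟨c, hc⟩ := cyclotomic.dvd_X_pow_sub_one n ℚ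
    refine ⟨(algebraMap ℚ[X] (RatFunc ℚ) c * t) ^ 2,
      L.pow_mem (L.mul_mem (algebraMap_mem_coprimeDenom _ c) htL) 2, ?_⟩
    have h1 : 1 - t = algebraMap ℚ[X] (RatFunc ℚ) (X ^ n - 1) * t := by
      simp only [map_sub, map_one, map_pow, RatFunc.algebraMap_X]
      rw [ht_def, inv_pow]
      field_simp
    rw [h1, hc, map_mul, map_pow]
    ring
  have hx1 : RatFunc.X ^ (-1 : ℤ) = q ^ (r + 1) * t := by
    rw [zpow_neg_one, hq_def, ht_def, ← pow_mul, inv_pow, hn_def, pow_succ]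
    field_simp
  have hx2 : q ^ (r + 1) * t ^ (e + 1) = (q ^ (e * (r + 1) + 1))⁻¹ := by
    rw [hq_def, ht_def, inv_pow, inv_pow, ← pow_mul, ← pow_mul, ← pow_mul, hn_def]
    rw [← div_eq_mul_inv, ← one_div, div_eq_div_iff (pow_ne_zero _ hX) (pow_ne_zero _ hX)]
    ring
  have hzero := sum_qPoch_inv_pow_mul_qPoch_pow_eq_zero hq0 hq e r n (e * (r + 1) + 1)
    (by rw [mul_add]; omega) (by rw [hn_def, add_mul]; omega)
  have hterm : ∀ k, ∃ c, k ∈ Finset.range n → c ∈ L ∧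
      qPoch (RatFunc.X ^ (-1 : ℤ)) q k ^ (e + 1) * RatFunc.X ^ ((e + 1) * k) /
          qPoch q q k ^ (e + 1) =
        qPoch (q ^ (e * (r + 1) + 1))⁻¹ q k * qPoch (q ^ (r + 1)) q k ^ e * q ^ k /
          qPoch q q k ^ (e + 1) +
        algebraMap ℚ[X] (RatFunc ℚ) (cyclotomic n ℚ ^ 2) * c := by
    intro k
    obtain ⟨c, hc, h⟩ := dvd_qPoch_pow_sub (L.pow_mem hqL (r + 1)) htL hqL e k
    rw [ht, ← hx1, hx2] at h
    refine ⟨c₀ * c * q ^ k * (qPoch q q k)⁻¹ ^ (e + 1), fun hk => ⟨?_, ?_⟩⟩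
    · exact L.mul_mem (L.mul_mem (L.mul_mem hc₀ hc) (L.pow_mem hqL k))
        (L.pow_mem (inv_qPoch_mem_coprimeDenom hcop (Finset.mem_range.1 hk)) _)
    · rw [pow_mul, ← hq_def, sub_eq_iff_eq_add.1 h, inv_pow]
      ring
  choose c hc using hterm
  refine ⟨∑ k ∈ Finset.range n, c k, ?_, ?_⟩
  · rw [Finset.sum_congr rfl fun k hk => (hc k hk).2, Finset.sum_add_distrib, hzero, zero_add,
      Finset.mul_sum]
  · exact L.sum_mem fun k hk => (hc k hk).1
end
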